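/- Consider feedforward neural networks of depth D ≥ 2 with widths n_0 = d, n_1, …, n_{D−1} ∈ ℕ⁺, n_D = 1 and activation ρ : ℝ → ℝ that is differentiable and satisfies |ρ(t)| ≤ 1, |ρ'(t)| ≤ 1 for all t, with ρ and ρ' both 1-Lipschitz. Let B_θ ≥ 1, let A > 0, and let a_{ij} : ℝ^d → ℝ (1 ≤ i,j ≤ d) satisfy |a_{ij}(x)| ≤ A for all i, j and all x. For parameter vectors θ_u, θ_v whose weights are bounded by B_θ, define g(x; θ_u, θ_v) = Σ_{i,j=1}^d a_{ij}(x) ∂_{x_i} f(x; θ_u) ∂_{x_j} f(x; θ_v). Then for all x ∈ ℝ^d with |x_j| ≤ 1 for all j: (i) |g(x; θ_u, θ_v)| ≤ A d² B_θ^{2D} (∏_{i=1}^{D−1} n_i)²; and (ii) for any further parameter vectors θ̃_u, θ̃_v with weights bounded by B_θ, |g(x; θ_u, θ_v) − g(x; θ̃_u, θ̃_v)| ≤ A d² √(2W) (D+1) B_θ^{3D} (∏_{i=1}^{D−1} n_i)³ · ‖(θ_u, θ_v) − (θ̃_u, θ̃_v)‖₂. -/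

import Mathlib

/-- Parameters of a feedforward neural network with widths `n 0, n 1, n 2, …`:
`A ℓ` is the `n (ℓ+1) × n ℓ` weight matrix and `b ℓ` the bias vector of layer `ℓ+1`. -/
structure NNParams (n : ℕ → ℕ) where
  A : (ℓ : ℕ) → Fin (n (ℓ + 1)) → Fin (n ℓ) → ℝ
  b : (ℓ : ℕ) → Fin (n (ℓ + 1)) → ℝ

/-- Hidden-layer outputs: `f⁰(x) = x`, `f^{ℓ+1}(x) = ρ(A_{ℓ+1} f^ℓ(x) + b_{ℓ+1})` entrywise. -/
noncomputable def nnHidden {n : ℕ → ℕ} (ρ : ℝ → ℝ) (θ : NNParams n) :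
    (ℓ : ℕ) → ((Fin (n 0) → ℝ) → Fin (n ℓ) → ℝ)
  | 0 => fun x => x
  | ℓ + 1 => fun x q => ρ ((∑ j, θ.A ℓ q j * nnHidden ρ θ ℓ x j) + θ.b ℓ q)

/-- Network output of depth `D`: the last layer is affine (no activation),
`f(x;θ) = A_D f^{D−1}(x;θ) + b_D`. -/
noncomputable def nnOut {n : ℕ → ℕ} (ρ : ℝ → ℝ) (θ : NNParams n) :
    (D : ℕ) → ((Fin (n 0) → ℝ) → Fin (n D) → ℝ)
  | 0 => fun x => x
  | D + 1 => fun x q => (∑ j, θ.A D q j * nnHidden ρ θ D x j) + θ.b D q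

/-- `W`: the total number of scalar parameters of a depth-`D` network. -/
def nnW (n : ℕ → ℕ) (D : ℕ) : ℕ :=
  ∑ ℓ ∈ Finset.range D, (n (ℓ + 1) * n ℓ + n (ℓ + 1))

/-- Squared Euclidean distance between the parameter vectors of two depth-`D` networks. -/
noncomputable def paramSq {n : ℕ → ℕ} (θ θ' : NNParams n) (D : ℕ) : ℝ :=
  ∑ ℓ ∈ Finset.range D,
    ((∑ q, ∑ j, (θ.A ℓ q j - θ'.A ℓ q j) ^ 2) + ∑ q, (θ.b ℓ q - θ'.b ℓ q) ^ 2)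

/-- Euclidean distance `‖θ − θ̃‖₂` between the parameter vectors of two depth-`D` networks. -/
noncomputable def paramDist {n : ℕ → ℕ} (θ θ' : NNParams n) (D : ℕ) : ℝ :=
  Real.sqrt (paramSq θ θ' D)

/-- All weights of the depth-`D` network `θ` are bounded in absolute value by `Bθ`. -/
def weightsBounded {n : ℕ → ℕ} (θ : NNParams n) (D : ℕ) (Bθ : ℝ) : Prop :=
  ∀ ℓ < D, (∀ q j, |θ.A ℓ q j| ≤ Bθ) ∧ (∀ q, |θ.b ℓ q| ≤ Bθ)

/-- Euclidean distance `‖(θu, θv) − (θ̃u, θ̃v)‖₂` between two pairs of depth-`D`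
parameter vectors (the pair being regarded as a vector in `ℝ^{2W}`). -/
noncomputable def pairDist {n : ℕ → ℕ} (θu θv θu' θv' : NNParams n) (D : ℕ) : ℝ :=
  Real.sqrt (paramSq θu θu' D + paramSq θv θv' D)

open Finset

/-- The product `n 1 * ⋯ * n ℓ` of the widths of the first `ℓ` hidden layers. -/
def widthProd (n : ℕ → ℕ) (ℓ : ℕ) : ℝ := ∏ i ∈ range ℓ, (n (i + 1) : ℝ)

theorem widthProd_succ (n : ℕ → ℕ) (ℓ : ℕ) :
    widthProd n (ℓ + 1) = widthProd n ℓ * n (ℓ + 1) := prod_range_succ _ _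

theorem one_le_widthProd {n : ℕ → ℕ} {ℓ : ℕ} (hpos : ∀ i ≤ ℓ, 0 < n i) : 1 ≤ widthProd n ℓ := by
  refine one_le_prod fun i hi => ?_
  exact_mod_cast hpos (i + 1) (mem_range.1 hi)

theorem prod_Icc_eq_widthProd (n : ℕ → ℕ) (ℓ : ℕ) :
    ∏ i ∈ Icc 1 ℓ, (n i : ℝ) = widthProd n ℓ := by
  induction ℓ with
  | zero => simp [widthProd]
  | succ ℓ ih => rw [prod_Icc_succ_top (by omega), ih, widthProd_succ]

/-- The `ℓ¹` distance between the parameters of layer `ℓ + 1`. -/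
def layerDist {n : ℕ → ℕ} (θ θ' : NNParams n) (ℓ : ℕ) : ℝ :=
  (∑ q, ∑ j, |θ.A ℓ q j - θ'.A ℓ q j|) + ∑ q, |θ.b ℓ q - θ'.b ℓ q|

/-- The `ℓ¹` distance between the parameters of the first `ℓ` layers. -/
def paramDistL1 {n : ℕ → ℕ} (θ θ' : NNParams n) (ℓ : ℕ) : ℝ :=
  ∑ k ∈ range ℓ, layerDist θ θ' k

section Distances

variable {n : ℕ → ℕ} (θ θ' : NNParams n)

theorem row_dist_add_bias_dist_le (ℓ : ℕ) (q : Fin (n (ℓ + 1))) :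
    ∑ j, |θ.A ℓ q j - θ'.A ℓ q j| + |θ.b ℓ q - θ'.b ℓ q| ≤ layerDist θ θ' ℓ :=
  add_le_add
    (single_le_sum (f := fun q => ∑ j, |θ.A ℓ q j - θ'.A ℓ q j|)
      (fun _ _ => sum_nonneg fun _ _ => abs_nonneg _) (mem_univ q))
    (single_le_sum (f := fun q => |θ.b ℓ q - θ'.b ℓ q|) (fun _ _ => abs_nonneg _) (mem_univ q))

theorem row_dist_le (ℓ : ℕ) (q : Fin (n (ℓ + 1))) :
    ∑ j, |θ.A ℓ q j - θ'.A ℓ q j| ≤ layerDist θ θ' ℓ :=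
  (le_add_of_nonneg_right (abs_nonneg _)).trans (row_dist_add_bias_dist_le θ θ' ℓ q)

theorem layerDist_nonneg (ℓ : ℕ) : 0 ≤ layerDist θ θ' ℓ := by
  unfold layerDist; positivity

theorem paramDistL1_nonneg (ℓ : ℕ) : 0 ≤ paramDistL1 θ θ' ℓ :=
  sum_nonneg fun _ _ => layerDist_nonneg _ _ _

theorem paramDistL1_succ (ℓ : ℕ) :
    paramDistL1 θ θ' (ℓ + 1) = paramDistL1 θ θ' ℓ + layerDist θ θ' ℓ := sum_range_succ _ _

theorem sq_layerDist_le (ℓ : ℕ) :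
    layerDist θ θ' ℓ ^ 2 ≤ ((n (ℓ + 1) * n ℓ + n (ℓ + 1) : ℕ) : ℝ) *
      ((∑ q, ∑ j, (θ.A ℓ q j - θ'.A ℓ q j) ^ 2) + ∑ q, (θ.b ℓ q - θ'.b ℓ q) ^ 2) := by
  have h := sq_sum_le_card_mul_sum_sq (s := (univ : Finset ((Fin (n (ℓ + 1)) × Fin (n ℓ)) ⊕
    Fin (n (ℓ + 1))))) (f := Sum.elim (fun p => |θ.A ℓ p.1 p.2 - θ'.A ℓ p.1 p.2|)
      (fun q => |θ.b ℓ q - θ'.b ℓ q|))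
  simpa [layerDist, Fintype.sum_prod_type, sq_abs] using h

theorem sq_paramDistL1_le (D : ℕ) :
    paramDistL1 θ θ' D ^ 2 ≤ nnW n D * paramSq θ θ' D := by
  unfold paramDistL1 nnW paramSq
  rw [Nat.cast_sum]
  refine sum_sq_le_sum_mul_sum_of_sq_le_mul _ (fun _ _ => by positivity)
    (fun _ _ => by positivity) fun ℓ _ => sq_layerDist_le θ θ' ℓ

theorem paramDistL1_add_le (θv θv' : NNParams n) (D : ℕ) :
    paramDistL1 θ θ' D + paramDistL1 θv θv' D ≤
      Real.sqrt (2 * nnW n D) * pairDist θ θv θ' θv' D := by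
  rw [pairDist, ← Real.sqrt_mul (by positivity)]
  apply Real.le_sqrt_of_sq_le
  nlinarith [sq_paramDistL1_le θ θ' D, sq_paramDistL1_le θv θv' D,
    sq_nonneg (paramDistL1 θ θ' D - paramDistL1 θv θv' D)]

end Distances

theorem abs_sum_mul_le {N : ℕ} {a u : Fin N → ℝ} {B U : ℝ} (hB : 0 ≤ B)
    (ha : ∀ j, |a j| ≤ B) (hu : ∀ j, |u j| ≤ U) : |∑ j, a j * u j| ≤ B * (N * U) := by
  calc |∑ j, a j * u j| ≤ ∑ j, |a j * u j| := abs_sum_le_sum_abs _ _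
    _ ≤ ∑ _j : Fin N, B * U := sum_le_sum fun j _ => by
        rw [abs_mul]; exact mul_le_mul (ha j) (hu j) (abs_nonneg _) hB
    _ = B * (N * U) := by simp; ring

theorem abs_sum_mul_sub_sum_mul_le {N : ℕ} {a a' u u' : Fin N → ℝ} {B U E : ℝ} (hB : 0 ≤ B)
    (ha : ∀ j, |a j| ≤ B) (hu : ∀ j, |u' j| ≤ U) (hE : ∀ j, |u j - u' j| ≤ E) :
    |∑ j, a j * u j - ∑ j, a' j * u' j| ≤ (∑ j, |a j - a' j|) * U + B * (N * E) := by
  have key : ∑ j, a j * u j - ∑ j, a' j * u' j =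
      ∑ j, (a j - a' j) * u' j + ∑ j, a j * (u j - u' j) := by
    rw [← sum_sub_distrib, ← sum_add_distrib]
    exact sum_congr rfl fun j _ => by ring
  rw [key]
  refine (abs_add_le _ _).trans (add_le_add ?_ (abs_sum_mul_le hB ha hE))
  rw [sum_mul]
  refine (abs_sum_le_sum_abs _ _).trans (sum_le_sum fun j _ => ?_)
  rw [abs_mul]
  exact mul_le_mul_of_nonneg_left (hu j) (abs_nonneg _)

theorem abs_mul_sub_mul_le (a b a' b' : ℝ) :
    |a * b - a' * b'| ≤ |a - a'| * |b| + |a'| * |b - b'| := by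
  rw [← abs_mul, ← abs_mul]
  refine le_trans (le_of_eq ?_) (abs_add_le _ _)
  ring_nf

/-- The Fréchet derivative at `x` of the affine output of layer `ℓ + 1`, by the chain rule. -/
noncomputable def nnGrad {n : ℕ → ℕ} (ρ : ℝ → ℝ) (θ : NNParams n) (x : Fin (n 0) → ℝ) :
    (ℓ : ℕ) → Fin (n (ℓ + 1)) → ((Fin (n 0) → ℝ) →L[ℝ] ℝ)
  | 0 => fun q => ∑ j, θ.A 0 q j • ContinuousLinearMap.proj j
  | ℓ + 1 => fun q =>
      ∑ j, θ.A (ℓ + 1) q j • (deriv ρ (nnOut ρ θ (ℓ + 1) x j) • nnGrad ρ θ x ℓ j)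

section Network

variable {n : ℕ → ℕ} {ρ : ℝ → ℝ}

theorem hasFDerivAt_nnOut (hρ : Differentiable ℝ ρ) (θ : NNParams n) (x : Fin (n 0) → ℝ)
    (ℓ : ℕ) (q : Fin (n (ℓ + 1))) :
    HasFDerivAt (fun y => nnOut ρ θ (ℓ + 1) y q) (nnGrad ρ θ x ℓ q) x := by
  induction ℓ with
  | zero =>
    exact (HasFDerivAt.fun_sum fun j _ => (hasFDerivAt_apply j x).const_mul (θ.A 0 q j)).add_const _
  | succ ℓ ih =>
    exact (HasFDerivAt.fun_sum fun j _ =>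
      ((hρ _).hasDerivAt.comp_hasFDerivAt x (ih j)).const_mul (θ.A (ℓ + 1) q j)).add_const _

theorem abs_nnHidden_le_one (hρb : ∀ t, |ρ t| ≤ 1) (θ : NNParams n) {x : Fin (n 0) → ℝ}
    (hx : ∀ j, |x j| ≤ 1) (ℓ : ℕ) (q : Fin (n ℓ)) : |nnHidden ρ θ ℓ x q| ≤ 1 := by
  cases ℓ with
  | zero => exact hx q
  | succ ℓ => exact hρb _

variable {D : ℕ} {B : ℝ} {θ θ' : NNParams n} {x v : Fin (n 0) → ℝ}

theorem abs_nnGrad_le (hB : 1 ≤ B) (hρ'b : ∀ t, |deriv ρ t| ≤ 1)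
    (hθ : weightsBounded θ D B) (hv : ∑ j, |v j| ≤ 1)
    {ℓ : ℕ} (hℓ : ℓ < D) (q : Fin (n (ℓ + 1))) :
    |nnGrad ρ θ x ℓ q v| ≤ B ^ (ℓ + 1) * widthProd n ℓ := by
  have hB0 : 0 ≤ B := zero_le_one.trans hB
  induction ℓ with
  | zero =>
    simp only [nnGrad, _root_.sum_apply, smul_apply,
      ContinuousLinearMap.proj_apply, smul_eq_mul]
    calc |∑ j, θ.A 0 q j * v j| ≤ ∑ j, |θ.A 0 q j * v j| := abs_sum_le_sum_abs _ _
      _ ≤ ∑ j, B * |v j| := sum_le_sum fun j _ => by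
          rw [abs_mul]; exact mul_le_mul_of_nonneg_right ((hθ 0 hℓ).1 q j) (abs_nonneg _)
      _ = B * ∑ j, |v j| := (mul_sum _ _ _).symm
      _ ≤ B * 1 := mul_le_mul_of_nonneg_left hv hB0
      _ = B ^ (0 + 1) * widthProd n 0 := by simp [widthProd]
  | succ ℓ ih =>
    simp only [nnGrad, _root_.sum_apply, smul_apply, smul_eq_mul]
    refine (abs_sum_mul_le hB0 ((hθ (ℓ + 1) hℓ).1 q)
      (U := B ^ (ℓ + 1) * widthProd n ℓ) fun j => ?_).trans_eq ?_
    · rw [abs_mul]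
      exact (mul_le_of_le_one_left (abs_nonneg _) (hρ'b _)).trans (ih (by omega) j)
    · rw [widthProd_succ]; ring

theorem abs_nnOut_sub_le (hB : 1 ≤ B) (hpos : ∀ i ≤ D, 0 < n i) (hρb : ∀ t, |ρ t| ≤ 1)
    (hρlip : ∀ s t, |ρ s - ρ t| ≤ |s - t|) (hθ : weightsBounded θ D B)
    (hx : ∀ j, |x j| ≤ 1) {ℓ : ℕ} (hℓ : ℓ < D) (q : Fin (n (ℓ + 1))) :
    |nnOut ρ θ (ℓ + 1) x q - nnOut ρ θ' (ℓ + 1) x q| ≤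
      B ^ ℓ * widthProd n ℓ * paramDistL1 θ θ' (ℓ + 1) := by
  have hB0 : 0 ≤ B := zero_le_one.trans hB
  have layer : ∀ ℓ < D, ∀ q : Fin (n (ℓ + 1)), ∀ E : ℝ,
      (∀ j, |nnHidden ρ θ ℓ x j - nnHidden ρ θ' ℓ x j| ≤ E) →
      |nnOut ρ θ (ℓ + 1) x q - nnOut ρ θ' (ℓ + 1) x q| ≤
        layerDist θ θ' ℓ + B * (n ℓ * E) := by
    intro ℓ hℓ q E hE
    have h := abs_sum_mul_sub_sum_mul_le (a' := θ'.A ℓ q) hB0 ((hθ ℓ hℓ).1 q)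
      (abs_nnHidden_le_one hρb θ' hx ℓ) hE
    have hrow := row_dist_add_bias_dist_le θ θ' ℓ q
    have habs := abs_add_le (∑ j, θ.A ℓ q j * nnHidden ρ θ ℓ x j -
      ∑ j, θ'.A ℓ q j * nnHidden ρ θ' ℓ x j) (θ.b ℓ q - θ'.b ℓ q)
    rw [← add_sub_add_comm] at habs
    simp only [nnOut]
    linarith
  induction ℓ with
  | zero =>
    have h := layer 0 hℓ q 0 (fun j => by simp [nnHidden])
    simpa [widthProd, paramDistL1] using h
  | succ ℓ ih =>
    refine (layer (ℓ + 1) hℓ q _ fun j => (hρlip _ _).trans (ih (by omega) j)).trans ?_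
    have hP : 1 ≤ B ^ (ℓ + 1) * widthProd n (ℓ + 1) :=
      one_le_mul_of_one_le_of_one_le (one_le_pow₀ hB)
        (one_le_widthProd fun i hi => hpos i (by omega))
    have hmul := le_mul_of_one_le_left (layerDist_nonneg θ θ' (ℓ + 1)) hP
    rw [paramDistL1_succ _ _ (ℓ + 1), mul_add, add_comm]
    refine add_le_add (le_of_eq ?_) hmul
    rw [widthProd_succ]; ring

theorem abs_nnGrad_sub_le (hB : 1 ≤ B) (hpos : ∀ i ≤ D, 0 < n i) (hρb : ∀ t, |ρ t| ≤ 1)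
    (hρ'b : ∀ t, |deriv ρ t| ≤ 1) (hρlip : ∀ s t, |ρ s - ρ t| ≤ |s - t|)
    (hρ'lip : ∀ s t, |deriv ρ s - deriv ρ t| ≤ |s - t|)
    (hθ : weightsBounded θ D B) (hθ' : weightsBounded θ' D B)
    (hx : ∀ j, |x j| ≤ 1) (hv : ∑ j, |v j| ≤ 1)
    {ℓ : ℕ} (hℓ : ℓ < D) (q : Fin (n (ℓ + 1))) :
    |nnGrad ρ θ x ℓ q v - nnGrad ρ θ' x ℓ q v| ≤
      (ℓ + 1) * (B ^ (ℓ + 1) * widthProd n ℓ) ^ 2 * paramDistL1 θ θ' (ℓ + 1) := by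
  have hB0 : 0 ≤ B := zero_le_one.trans hB
  induction ℓ with
  | zero =>
    have hv1 : ∀ j, |v j| ≤ 1 := fun j =>
      (single_le_sum (f := fun j => |v j|) (fun _ _ => abs_nonneg _) (mem_univ j)).trans hv
    have h := abs_sum_mul_sub_sum_mul_le (a' := θ'.A 0 q) (u := v) (E := 0) hB0 ((hθ 0 hℓ).1 q) hv1
      (by simp)
    have hmul := le_mul_of_one_le_left (layerDist_nonneg θ θ' 0) (one_le_pow₀ (n := 2) hB)
    have hrow := row_dist_le θ θ' 0 q
    simp only [nnGrad, _root_.sum_apply, smul_apply,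
      ContinuousLinearMap.proj_apply, smul_eq_mul]
    simp only [widthProd, paramDistL1, range_zero, prod_empty]
    norm_num
    linarith
  | succ ℓ ih =>
    have hlt : ℓ < D := by omega
    set G := B ^ (ℓ + 1) * widthProd n ℓ with hG
    set δ := paramDistL1 θ θ' (ℓ + 1) with hδ
    set N := (n (ℓ + 1) : ℝ) with hN
    have hW : 1 ≤ widthProd n ℓ := one_le_widthProd fun i hi => hpos i (by omega)
    have hG1 : 1 ≤ G := one_le_mul_of_one_le_of_one_le (one_le_pow₀ hB) hW
    have hδ0 : 0 ≤ δ := paramDistL1_nonneg _ _ _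
    have hN1 : 1 ≤ N := by rw [hN]; exact_mod_cast hpos (ℓ + 1) (by omega)
    have hBN : 1 ≤ B * N := one_le_mul_of_one_le_of_one_le hB hN1
    have hL := layerDist_nonneg θ θ' (ℓ + 1)
    have hbound : ∀ j, |deriv ρ (nnOut ρ θ' (ℓ + 1) x j) * nnGrad ρ θ' x ℓ j v| ≤ G := fun j => by
      rw [abs_mul]
      exact (mul_le_of_le_one_left (abs_nonneg _) (hρ'b _)).trans
        (abs_nnGrad_le hB hρ'b hθ' hv hlt j)
    have hdiff : ∀ j, |deriv ρ (nnOut ρ θ (ℓ + 1) x j) * nnGrad ρ θ x ℓ j v -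
        deriv ρ (nnOut ρ θ' (ℓ + 1) x j) * nnGrad ρ θ' x ℓ j v| ≤ (ℓ + 2) * G ^ 2 * δ := fun j => by
      have hpre : |deriv ρ (nnOut ρ θ (ℓ + 1) x j) - deriv ρ (nnOut ρ θ' (ℓ + 1) x j)| ≤ G * δ := by
        refine (hρ'lip _ _).trans ((abs_nnOut_sub_le hB hpos hρb hρlip hθ hx hlt j).trans ?_)
        rw [hG]
        gcongr
        omega
      have hgrad : |nnGrad ρ θ x ℓ j v| ≤ G := abs_nnGrad_le hB hρ'b hθ hv hlt j
      refine (abs_mul_sub_mul_le _ _ _ _).trans ?_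
      have hfst := mul_le_mul hpre hgrad (abs_nonneg _) (by positivity)
      have hsnd := (mul_le_of_le_one_left (abs_nonneg _)
        (hρ'b (nnOut ρ θ' (ℓ + 1) x j))).trans (ih hlt j)
      linarith
    have h := abs_sum_mul_sub_sum_mul_le (a' := θ'.A (ℓ + 1) q) hB0 ((hθ (ℓ + 1) hℓ).1 q)
      hbound hdiff
    simp only [nnGrad, _root_.sum_apply, smul_apply, smul_eq_mul]
    refine h.trans ?_
    have hsucc : B ^ (ℓ + 1 + 1) * widthProd n (ℓ + 1) = B * N * G := by
      rw [widthProd_succ, hG]; ring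
    rw [hsucc, paramDistL1_succ _ _ (ℓ + 1), ← hδ]
    have hBNsq : B * N ≤ (B * N) ^ 2 := le_self_pow₀ hBN two_ne_zero
    have hGle : G ≤ (ℓ + 2) * (B * N * G) ^ 2 := by
      have hGG : G ≤ B * N * G := le_mul_of_one_le_left (by positivity) hBN
      have hsq : B * N * G ≤ (B * N * G) ^ 2 := le_self_pow₀ (hG1.trans hGG) two_ne_zero
      have := le_mul_of_one_le_left (a := (ℓ + 2 : ℝ)) (sq_nonneg (B * N * G))
        (by have : (0 : ℝ) ≤ ℓ := by positivity
            linarith)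
      linarith
    have hfst : (∑ j, |θ.A (ℓ + 1) q j - θ'.A (ℓ + 1) q j|) * G ≤
        (ℓ + 2) * (B * N * G) ^ 2 * layerDist θ θ' (ℓ + 1) := by
      rw [mul_comm]
      exact mul_le_mul hGle (row_dist_le θ θ' (ℓ + 1) q)
        (sum_nonneg fun _ _ => abs_nonneg _) (by positivity)
    have hsnd : B * (N * ((ℓ + 2) * G ^ 2 * δ)) ≤ (ℓ + 2) * (B * N * G) ^ 2 * δ := by
      calc B * (N * ((ℓ + 2) * G ^ 2 * δ)) = (B * N) * ((ℓ + 2) * G ^ 2 * δ) := by ring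
        _ ≤ (B * N) ^ 2 * ((ℓ + 2) * G ^ 2 * δ) := by gcongr
        _ = _ := by ring
    push_cast
    linarith

end Network

theorem abs_sum_sum_le {N : ℕ} {c : Fin N → Fin N → ℝ} {C : ℝ} (hc : ∀ i j, |c i j| ≤ C) :
    |∑ i, ∑ j, c i j| ≤ (N : ℝ) ^ 2 * C := by
  calc |∑ i, ∑ j, c i j| ≤ ∑ i, ∑ j, |c i j| :=
        (abs_sum_le_sum_abs _ _).trans (sum_le_sum fun _ _ => abs_sum_le_sum_abs _ _)
    _ ≤ ∑ _i : Fin N, ∑ _j : Fin N, C := sum_le_sum fun i _ => sum_le_sum fun j _ => hc i j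
    _ = (N : ℝ) ^ 2 * C := by simp; ring

/-- **Lemma 5.12, class `F₁ = {Σ_{i,j} a_{ij} ∂_i u ∂_j v}`.** For depth `D ≥ 2` networks
with widths `n 0 = d ≥ 1`, …, `n D = 1`, differentiable activation `ρ` with `|ρ| ≤ 1`,
`|ρ'| ≤ 1` and `ρ, ρ'` `1`-Lipschitz, coefficients `|a_{ij}| ≤ A`, and parameter vectors
with weights bounded by `Bθ ≥ 1`, the function
`g(x; θu, θv) = Σ_{i,j} a_{ij}(x) ∂_{x_i} f(x;θu) ∂_{x_j} f(x;θv)` satisfies, for every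
`x` with `|x j| ≤ 1`:
(i) `|g(x; θu, θv)| ≤ A d² Bθ^{2D} (∏_{i=1}^{D−1} n i)²`, and
(ii) `|g(x; θu, θv) − g(x; θ̃u, θ̃v)|
      ≤ A d² √(2W) (D+1) Bθ^{3D} (∏_{i=1}^{D−1} n i)³ ‖(θu,θv) − (θ̃u,θ̃v)‖₂`. -/
theorem galerkin_gradient_class_bounds (D : ℕ) (hD : 2 ≤ D) (n : ℕ → ℕ)
    (hd : 1 ≤ n 0) (hnD : n D = 1) (hpos : ∀ i ≤ D, 0 < n i)
    (ρ : ℝ → ℝ) (hρdiff : Differentiable ℝ ρ)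
    (hρb : ∀ t, |ρ t| ≤ 1) (hρ'b : ∀ t, |deriv ρ t| ≤ 1)
    (hρlip : ∀ s t, |ρ s - ρ t| ≤ |s - t|)
    (hρ'lip : ∀ s t, |deriv ρ s - deriv ρ t| ≤ |s - t|)
    (Bθ : ℝ) (hBθ : 1 ≤ Bθ) (A : ℝ) (hA : 0 < A)
    (a : Fin (n 0) → Fin (n 0) → (Fin (n 0) → ℝ) → ℝ)
    (ha : ∀ i j x, |a i j x| ≤ A)
    (θu θv : NNParams n) (hθu : weightsBounded θu D Bθ) (hθv : weightsBounded θv D Bθ)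
    (x : Fin (n 0) → ℝ) (hx : ∀ j, |x j| ≤ 1) (qu qv : Fin (n D)) :
    (|∑ i, ∑ j, a i j x *
          fderiv ℝ (fun y => nnOut ρ θu D y qu) x (Pi.single i 1) *
          fderiv ℝ (fun y => nnOut ρ θv D y qv) x (Pi.single j 1)| ≤
        A * (n 0 : ℝ) ^ 2 * Bθ ^ (2 * D) * (∏ i ∈ Finset.Icc 1 (D - 1), (n i : ℝ)) ^ 2) ∧
    (∀ θu' θv' : NNParams n, weightsBounded θu' D Bθ → weightsBounded θv' D Bθ →
      |(∑ i, ∑ j, a i j x *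
            fderiv ℝ (fun y => nnOut ρ θu D y qu) x (Pi.single i 1) *
            fderiv ℝ (fun y => nnOut ρ θv D y qv) x (Pi.single j 1)) -
          (∑ i, ∑ j, a i j x *
            fderiv ℝ (fun y => nnOut ρ θu' D y qu) x (Pi.single i 1) *
            fderiv ℝ (fun y => nnOut ρ θv' D y qv) x (Pi.single j 1))| ≤
        A * (n 0 : ℝ) ^ 2 * Real.sqrt (2 * nnW n D) * (D + 1) * Bθ ^ (3 * D) *
          (∏ i ∈ Finset.Icc 1 (D - 1), (n i : ℝ)) ^ 3 * pairDist θu θv θu' θv' D) := by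
  obtain ⟨m, rfl⟩ : ∃ m, D = m + 1 := ⟨D - 1, by omega⟩
  have hm : m < m + 1 := Nat.lt_succ_self m
  have hv : ∀ p : Fin (n 0), ∑ j, |(Pi.single p 1 : Fin (n 0) → ℝ) j| ≤ 1 := fun p => by
    simp [Pi.single_apply, apply_ite abs]
  have hW : 1 ≤ widthProd n m := one_le_widthProd fun i hi => hpos i (by omega)
  simp only [(hasFDerivAt_nnOut hρdiff _ x m _).fderiv, Nat.add_sub_cancel,
    prod_Icc_eq_widthProd]
  set G := Bθ ^ (m + 1) * widthProd n m with hG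
  have hG1 : 1 ≤ G := one_le_mul_of_one_le_of_one_le (one_le_pow₀ hBθ) hW
  have hbound : ∀ θ : NNParams n, weightsBounded θ (m + 1) Bθ → ∀ q p,
      |nnGrad ρ θ x m q (Pi.single p 1)| ≤ G := fun θ hθ q p =>
    abs_nnGrad_le hBθ hρ'b hθ (hv p) hm q
  refine ⟨?_, fun θu' θv' hθu' hθv' => ?_⟩
  · refine (abs_sum_sum_le (C := A * G * G) fun i j => ?_).trans_eq ?_
    · rw [abs_mul, abs_mul]
      gcongr
      · exact ha i j x
      · exact hbound θu hθu qu i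
      · exact hbound θv hθv qv j
    · rw [hG]; ring
  · have hdiff : ∀ θ θ' : NNParams n, weightsBounded θ (m + 1) Bθ →
        weightsBounded θ' (m + 1) Bθ → ∀ q p,
        |nnGrad ρ θ x m q (Pi.single p 1) - nnGrad ρ θ' x m q (Pi.single p 1)| ≤
          (m + 1) * G ^ 2 * paramDistL1 θ θ' (m + 1) := fun θ θ' hθ hθ' q p =>
      abs_nnGrad_sub_le hBθ hpos hρb hρ'b hρlip hρ'lip hθ hθ' hx (hv p) hm q
    simp only [← sum_sub_distrib]
    set S := Real.sqrt (2 * nnW n (m + 1)) * pairDist θu θv θu' θv' (m + 1) with hS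
    have hS0 : 0 ≤ S := mul_nonneg (Real.sqrt_nonneg _) (Real.sqrt_nonneg _)
    refine (abs_sum_sum_le (C := A * ((m + 1) * G ^ 3 * S)) fun i j => ?_).trans ?_
    · rw [mul_assoc, mul_assoc, ← mul_sub, abs_mul]
      refine mul_le_mul (ha i j x) ?_ (abs_nonneg _) hA.le
      refine (abs_mul_sub_mul_le _ _ _ _).trans ?_
      have hu := mul_le_mul (hdiff θu θu' hθu hθu' qu i) (hbound θv hθv qv j) (abs_nonneg _)
        (mul_nonneg (by positivity) (paramDistL1_nonneg _ _ _))
      have hv := mul_le_mul (hbound θu' hθu' qu i) (hdiff θv θv' hθv hθv' qv j) (abs_nonneg _)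
        (by positivity)
      have hsum := mul_le_mul_of_nonneg_left (paramDistL1_add_le θu θu' θv θv' (m + 1))
        (show 0 ≤ (m + 1) * G ^ 3 by positivity)
      linarith
    · calc (n 0 : ℝ) ^ 2 * (A * ((m + 1) * G ^ 3 * S))
          ≤ (n 0 : ℝ) ^ 2 * (A * ((m + 1 + 1) * G ^ 3 * S)) := by gcongr; linarith
        _ = _ := by rw [hG, hS]; push_cast; ring
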